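/- Fix integers n, k ≥ 1. Let A, B ∈ SL(2,ℝ) be such that B(ℤ²) = R(L_Δ) for some rotation R ∈ SO(2), while A(ℤ²) ≠ R(L_Δ) for every rotation R ∈ SO(2). Suppose h_A > 0 and h_B > 0 satisfy f_{h_A}(A) = 1/k and f_{h_B}(B) = 1/k. Then h_B < h_A. -/

import Mathlib

noncomputable section

/-- The linear action of a 2×2 real matrix on the Euclidean plane. -/
def act (A : Matrix (Fin 2) (Fin 2) ℝ) (v : EuclideanSpace ℝ (Fin 2)) :
    EuclideanSpace ℝ (Fin 2) :=
  (WithLp.equiv 2 (Fin 2 → ℝ)).symm (A.mulVec (WithLp.equiv 2 (Fin 2 → ℝ) v))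

/-- The standard integer lattice `ℤ² ⊂ ℝ²`. -/
def intLat : Set (EuclideanSpace ℝ (Fin 2)) :=
  {v | ∃ a b : ℤ, v 0 = (a : ℝ) ∧ v 1 = (b : ℝ)}

/-- The unimodular equilateral triangular lattice, spanned by `c•(1,0)` and
`c•(1/2, √3/2)` with `c = (2/√3)^(1/2)`, so that its covolume is `1`. -/
def triLat : Set (EuclideanSpace ℝ (Fin 2)) :=
  {v | ∃ a b : ℤ,
    v 0 = (a : ℝ) * Real.sqrt (2 / Real.sqrt 3)
        + (b : ℝ) * Real.sqrt (2 / Real.sqrt 3) / 2 ∧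
    v 1 = (b : ℝ) * Real.sqrt (2 / Real.sqrt 3) * Real.sqrt 3 / 2}

/-- `R` belongs to the rotation group `SO(2)`. -/
def IsRotation (R : Matrix (Fin 2) (Fin 2) ℝ) : Prop :=
  R.det = 1 ∧ R * R.transpose = 1

/-- The scaled standard lattice `Λ = (1/√(n(k+1))) ℤ² \ {0}`. -/
def Lam (n k : ℕ) : Set (EuclideanSpace ℝ (Fin 2)) :=
  {v | ∃ a b : ℤ, ¬(a = 0 ∧ b = 0) ∧
    v 0 = (a : ℝ) / Real.sqrt (n * (k + 1)) ∧ v 1 = (b : ℝ) / Real.sqrt (n * (k + 1))}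

/-- `f_t(A) = ∑_{v ∈ A(Λ)} exp (-t ‖v‖)`. -/
def fEnt (n k : ℕ) (t : ℝ) (A : Matrix (Fin 2) (Fin 2) ℝ) : ℝ :=
  ∑' v : (act A '' Lam n k), Real.exp (-t * ‖(v : EuclideanSpace ℝ (Fin 2))‖)


theorem cosh_taylor (y : ℝ) : 1 + y^2/2 + y^4/24 + y^6/720 ≤ Real.cosh y := by
  have h := sum_le_hasSum (Finset.range 4) (fun i _ => by
    have : (0:ℝ) ≤ y^(2*i) := by rw [pow_mul]; positivity
    positivity) (Real.hasSum_cosh y)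
  simp [Finset.sum_range_succ, Nat.factorial] at h
  linarith

theorem exp_upper4 (s : ℝ) (h0 : 0 ≤ s) (h1 : s ≤ 1) :
    Real.exp s ≤ 1 + s + s^2/2 + s^3/6 + 5*s^4/96 := by
  have h := Real.exp_bound' h0 h1 (n := 4) (by norm_num)
  simp [Finset.sum_range_succ, Nat.factorial] at h
  norm_num at h
  linarith

theorem exp_lower3 (s : ℝ) (h0 : 0 ≤ s) : 1 + s + s^2/2 + s^3/6 ≤ Real.exp s := by
  have h := Real.sum_le_exp_of_nonneg h0 4
  simp [Finset.sum_range_succ, Nat.factorial] at h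
  linarith

theorem exp_lower6 (s : ℝ) (h0 : 0 ≤ s) :
    1 + s + s^2/2 + s^3/6 + s^4/24 + s^5/120 + s^6/720 ≤ Real.exp s := by
  have h := Real.sum_le_exp_of_nonneg h0 7
  simp [Finset.sum_range_succ, Nat.factorial] at h
  linarith

theorem Fa (B z : ℝ) (hB : 5/2 ≤ B) (hz : 0 ≤ z) (hz2 : z ≤ 1/2) :
    Real.exp (B*z^2) ≤ Real.cosh (B*z) := by
  by_cases hy : 5/4 ≤ B*z
  · have h1 : Real.exp (B*z^2) ≤ Real.exp (B*z/2) := by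
      apply Real.exp_le_exp.2; nlinarith
    refine h1.trans ?_
    set x := Real.exp (B*z/2) with hx
    have hx1 : (37/20:ℝ) ≤ x := by
      have := exp_lower6 (5/8) (by norm_num)
      have h2 : Real.exp (5/8) ≤ x := Real.exp_le_exp.2 (by linarith)
      norm_num at this
      linarith
    have e1 : Real.exp (B*z) = x^2 := by rw [hx, ← Real.exp_nat_mul]; congr 1; push_cast; ring
    have e2 : Real.exp (-(B*z)) = (x^2)⁻¹ := by rw [Real.exp_neg, e1]
    rw [Real.cosh_eq, e1, e2]
    have hx0 : 0 < x^2 := by positivity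
    rw [le_div_iff₀ (by norm_num)]
    have : x^2 * (x^2)⁻¹ = 1 := mul_inv_cancel₀ hx0.ne'
    have key : x * 2 * x^2 ≤ (x^2 + (x^2)⁻¹) * x^2 := by
      have : (x^2 + (x^2)⁻¹) * x^2 = x^4 + 1 := by field_simp
      rw [this]
      have h3 : 0 ≤ (x-1) * (x^3-x^2-x-1) := by
        apply mul_nonneg (by linarith)
        nlinarith [mul_nonneg (sub_nonneg.2 hx1) (sub_nonneg.2 hx1), mul_nonneg (mul_nonneg (sub_nonneg.2 hx1) (sub_nonneg.2 hx1)) (sub_nonneg.2 hx1)]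
      nlinarith
    exact le_of_mul_le_mul_right key hx0
  · push Not at hy
    have hy0 : 0 ≤ B*z := by positivity
    set y := B*z with hyd
    set s := 2/5*y^2 with hs
    have hs1 : s ≤ 5/8 := by rw [hs]; nlinarith
    have hs0 : 0 ≤ s := by positivity
    have h1 : Real.exp (B*z^2) ≤ Real.exp s := by
      apply Real.exp_le_exp.2
      rw [hs, hyd]
      have : 0 ≤ B*z^2*(B-5/2) := by apply mul_nonneg; positivity; linarith
      nlinarith
    have h2 := exp_upper4 s hs0 (by linarith)
    have h3 := cosh_taylor y
    have ey : y^2 = 5/2*s := by rw [hs]; ring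
    have e4 : y^4 = (5/2*s)^2 := by rw [← ey]; ring
    have e6 : y^6 = (5/2*s)^3 := by rw [← ey]; ring
    rw [ey, e4, e6] at h3
    have : 1 + s + s^2/2 + s^3/6 + 5*s^4/96 ≤ 1 + 5/2*s/2 + (5/2*s)^2/24 + (5/2*s)^3/720 := by
      have h5 : 0 ≤ s * (1/4 - (1/2-25/96)*s - (1/6)*s^2 - 5/96*s^3) := by
        apply mul_nonneg hs0
        have : s^2 ≤ (5/8)^2 := by gcongr
        have : s^3 ≤ (5/8)^3 := by gcongr
        linarith
      have h6 : 0 ≤ s^3 := by positivity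
      nlinarith
    linarith

theorem Fb (B z : ℝ) (hB : 29/10 ≤ B) (hz : 0 ≤ z) (hz2 : z ≤ 1/2) :
    Real.exp (B*z^2) * (1 + 3/100 * min 1 (B*z^2)) ≤ Real.cosh (B*z) := by
  have hm0 : 0 ≤ min 1 (B*z^2) := le_min (by norm_num) (by positivity)
  by_cases hy : 29/20 ≤ B*z
  · have h1 : Real.exp (B*z^2) ≤ Real.exp (B*z/2) := by
      apply Real.exp_le_exp.2; nlinarith
    have h1' : Real.exp (B*z^2) * (1 + 3/100 * min 1 (B*z^2)) ≤ Real.exp (B*z/2) * (1 + 3/100 * 1) := by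
      gcongr
      exact min_le_left _ _
    refine h1'.trans ?_
    set x := Real.exp (B*z/2) with hx
    have hx1 : (206/100:ℝ) ≤ x := by
      have := exp_lower6 (29/40) (by norm_num)
      have h2 : Real.exp (29/40) ≤ x := Real.exp_le_exp.2 (by linarith)
      norm_num at this
      linarith
    have e1 : Real.exp (B*z) = x^2 := by rw [hx, ← Real.exp_nat_mul]; congr 1; push_cast; ring
    have := Real.exp_pos (-(B*z))
    rw [Real.cosh_eq, e1]
    nlinarith
  · push Not at hy
    have hy0 : 0 ≤ B*z := by positivity
    set y := B*z with hyd
    set s := 10/29*y^2 with hs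
    have hs1 : s ≤ 29/40 := by rw [hs]; nlinarith
    have hs0 : 0 ≤ s := by positivity
    have h0 : B*z^2 ≤ s := by
      rw [hs, hyd]
      have : 0 ≤ B*z^2*(B-29/10) := by apply mul_nonneg; positivity; linarith
      nlinarith
    have h1 : Real.exp (B*z^2) * (1 + 3/100 * min 1 (B*z^2)) ≤ (1 + s + s^2/2 + s^3/6 + 5*s^4/96) * (1 + 3/100 * s) := by
      have h2 := exp_upper4 s hs0 (by linarith)
      gcongr
      · exact (Real.exp_le_exp.2 h0).trans h2
      · exact (min_le_right _ _).trans h0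
    have h3 := cosh_taylor y
    have ey : y^2 = 29/10*s := by rw [hs]; ring
    have e4 : y^4 = (29/10*s)^2 := by rw [← ey]; ring
    have e6 : y^6 = (29/10*s)^3 := by rw [← ey]; ring
    rw [ey, e4, e6] at h3
    have : (1 + s + s^2/2 + s^3/6 + 5*s^4/96) * (1 + 3/100 * s)≤ 1 + 29/10*s/2 + (29/10*s)^2/24 + (29/10*s)^3/720 := by
      have h5 : 0 ≤ s * (42/100 - 18/100*s - 16/100*s^2 - 6/100*s^3-1/500*s^4) := by
        apply mul_nonneg hs0
        have : s^2 ≤ (29/40)^2 := by gcongr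
        have : s^3 ≤ (29/40)^3 := by gcongr
        have : s^4 ≤ (29/40)^4 := by gcongr
        linarith
      have h6 : 0 ≤ s^2 := by positivity
      have h6 : 0 ≤ s^3 := by positivity
      have h6 : 0 ≤ s^4 := by positivity
      have h6 : 0 ≤ s^5 := by positivity
      nlinarith
    linarith

theorem Gamma_bound (b B z : ℝ) (hb : 3627/1000 ≤ b) (hB : 0 < B) (hBb : B ≤ b) (hz : 0 ≤ z)
    (hz2 : z ≤ 1/2) :
    4/100 * min 1 ((b-B)^2/(2*B) + 2/3*(B*z^2)) ≤
      Real.exp (b-B) + 2 * Real.exp (-((b-B)*(3*b-B)/(4*B))) *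
        (Real.exp (-(B*z^2)) * Real.cosh (B*z)) - 3 := by
  obtain ⟨w, hw⟩ : ∃ w, w = b - B := ⟨_, rfl⟩
  have hw0 : 0 ≤ w := by linarith
  have hm1 := min_le_left 1 ((b-B)^2/(2*B) + 2/3*(B*z^2))
  have hm2 := min_le_right 1 ((b-B)^2/(2*B) + 2/3*(B*z^2))
  rw [← hw] at hm1 hm2 ⊢
  have ha : (w*(3*b-B)/(4*B)) = w/2 + 3*w^2/(4*B) := by
    have : b = B + w := by linarith
    rw [this]; field_simp; ring
  rw [ha]
  have hF0 : 0 ≤ Real.exp (-(B*z^2)) * Real.cosh (B*z) := by positivity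
  by_cases h1 : 112/100 ≤ w
  · have e1 : Real.exp (112/100) ≤ Real.exp w := Real.exp_le_exp.2 h1
    have e2 := exp_lower6 (112/100) (by norm_num)
    have e3 : (304/100:ℝ) ≤ 1 + 112/100 + (112/100)^2/2 + (112/100)^3/6 + (112/100)^4/24 + (112/100)^5/120 + (112/100)^6/720 := by norm_num
    have : 0 ≤ 2 * Real.exp (-(w/2 + 3*w^2/(4*B))) *
        (Real.exp (-(B*z^2)) * Real.cosh (B*z)) := by positivity
    linarith
  push Not at h1
  have hBl : 2507/1000 ≤ B := by linarith
  have e1 := exp_lower3 w hw0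
  have e2 : 1 - (w/2 + 3*w^2/(4*B)) ≤ Real.exp (-(w/2 + 3*w^2/(4*B))) := by
    have := Real.add_one_le_exp (-(w/2 + 3*w^2/(4*B))); linarith
  have hpoly : 8/100 * w^2 ≤ w^2/2 + w^3/6 - 3*w^2/(2*B) := by
    have : 1/B * 3/2 ≤ 1/2 + w/6 - 8/100 := by
      rw [div_mul_eq_mul_div, div_div, div_le_iff₀ (by linarith)]
      nlinarith
    have h2 : 3*w^2/(2*B) = w^2 * (1/B*3/2) := by field_simp
    rw [h2]
    nlinarith [sq_nonneg w]
  have hpoly2 : 3*w^2/(2*B) = 2*(3*w^2/(4*B)) := by field_simp; ring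
  set a := w/2 + 3*w^2/(4*B) with had
  have hea := Real.exp_pos (-a)
  set F := Real.exp (-(B*z^2)) * Real.cosh (B*z) with hF
  have hF1 : 1 ≤ F := by
    have := Fa B z (by linarith) hz hz2
    rw [hF, Real.exp_neg, inv_mul_eq_div, le_div_iff₀ (Real.exp_pos _)]; linarith
  by_cases h2 : 72/100 ≤ w
  · have : 2 * Real.exp (-a) * 1 ≤ 2 * Real.exp (-a) * F := by gcongr
    have hw2 : (72/100)^2 ≤ w^2 := by gcongr
    norm_num at hw2
    linarith
  push Not at h2
  have hBl : 29/10 ≤ B := by linarith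
  have hF2 : 1 + 3/100 * min 1 (B*z^2) ≤ F := by
    have := Fb B z (by linarith) hz hz2
    rw [hF, Real.exp_neg, inv_mul_eq_div, le_div_iff₀ (Real.exp_pos _)]; linarith
  have hm0 : 0 ≤ min 1 (B*z^2) := le_min (by norm_num) (by positivity)
  have ha2 : 3*w^2/(4*B) ≤ 14/100 := by
    rw [div_le_iff₀ (by linarith)]; nlinarith
  have ha3 : 1/2 ≤ Real.exp (-a) := by
    have : w/2 ≤ 36/100 := by linarith
    rw [had] at e2 ⊢
    linarith
  have h3 : 2 * Real.exp (-a) * F ≥ 2 * Real.exp (-a) + 3/100 * min 1 (B*z^2) := by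
    have := mul_le_mul (show 1 ≤ 2 * Real.exp (-a) by linarith) (show 3/100 * min 1 (B*z^2) ≤ F - 1 by linarith) (by positivity) (by positivity)
    linarith
  have h4 : min 1 (w^2/(2*B) + 2/3*(B*z^2)) ≤ w^2/(2*B) + 2/3 * min 1 (B*z^2) ∨ 1 ≤ B*z^2:= by
    by_cases h : 1 ≤ B*z^2
    · right; exact h
    · left; rw [min_eq_right (a := 1) (b := B*z^2) (by linarith)]; exact hm2
  have h5 : w^2/(2*B) ≤ w^2 := by
    rw [div_le_iff₀ (by linarith)]; nlinarith [sq_nonneg w]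
  rcases h4 with h4 | h4
  · have := sq_nonneg w
    linarith
  · have hq : 0 ≤ (B*z)*(1/2-z) := mul_nonneg (by positivity) (by linarith)
    have hq2 : (B*z)*(1/2-z) = B*z/2 - B*z^2 := by ring
    have h6 : Real.exp 1 ≤ Real.exp (-(B*z^2) + B*z) := Real.exp_le_exp.2 (by linarith)
    have h7 : 27/20 ≤ F := by
      have h8 := Real.exp_one_gt_d9
      have h9 : F = (Real.exp (-(B*z^2) + B*z) + Real.exp (-(B*z^2)) * Real.exp (-(B*z)))/2 := by
        rw [hF, Real.cosh_eq, Real.exp_add]; ring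
      have : 0 < Real.exp (-(B*z^2)) * Real.exp (-(B*z)) := by positivity
      rw [h9]; linarith
    have h10 : 2 * Real.exp (-a) * F ≥ 2 * Real.exp (-a) + 7/20 := by
      have := mul_le_mul (show 1 ≤ 2 * Real.exp (-a) by linarith) (show 7/20 ≤ F - 1 by linarith) (by norm_num) (by positivity)
      linarith
    have := sq_nonneg w
    linarith

noncomputable def qf (x y : ℝ) (p : ℤ × ℤ) : ℝ := (((p.1:ℝ) + p.2*x)^2 + (p.2*y)^2)/y

noncomputable def theta (β x y : ℝ) : ℝ := ∑' p : ℤ × ℤ, Real.exp (-(β * qf x y p))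

theorem summable_gauss1 (c : ℝ) (hc : 0 < c) : Summable (fun n : ℤ => Real.exp (-(c * (n:ℝ)^2))) := by
  have h := (HurwitzZeta.hasSum_int_evenKernel 0 (t := c / Real.pi) (by positivity)).summable
  refine h.congr (fun n => ?_)
  congr 1
  have := Real.pi_pos
  field_simp
  ring

theorem summable_theta (β x y : ℝ) (hβ : 0 < β) (hy : 0 < y) :
    Summable (fun p : ℤ × ℤ => Real.exp (-(β * qf x y p))) := by
  obtain ⟨K, hK⟩ : ∃ K, K = 2 + (2*x^2+1)/y^2 := ⟨_, rfl⟩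
  have hK0 : 0 < K := by rw [hK]; positivity
  obtain ⟨c, hc⟩ : ∃ c, c = β/(y*K) := ⟨_, rfl⟩
  have hc0 : 0 < c := by rw [hc]; positivity
  have h1 := summable_gauss1 c hc0
  have h2 := h1.mul_of_nonneg h1 (fun _ => (Real.exp_pos _).le) (fun _ => (Real.exp_pos _).le)
  refine Summable.of_nonneg_of_le (fun _ => (Real.exp_pos _).le) (fun p => ?_) h2
  rw [← Real.exp_add]
  apply Real.exp_le_exp.2
  obtain ⟨m, n⟩ := p
  have key : (m:ℝ)^2 + (n:ℝ)^2 ≤ K * (((m:ℝ) + n*x)^2 + (n*y)^2) := by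
    have e : K * (((m:ℝ) + n*x)^2 + (n*y)^2) = 2*((m:ℝ) + n*x)^2 + 2*(n*y)^2 + (2*x^2+1)/y^2*((m:ℝ) + n*x)^2 + (2*x^2+1)*n^2 := by
      rw [hK]; field_simp; ring
    rw [e]
    have : 0 ≤ (2*x^2+1)/y^2*((m:ℝ) + n*x)^2 := by positivity
    nlinarith [sq_nonneg ((m:ℝ) + 2*n*x), sq_nonneg ((n:ℝ)*y)]
  have e2 : β * qf x y (m,n) = c * (K * (((m:ℝ) + n*x)^2 + (n*y)^2)) := by
    rw [hc, qf]; field_simp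
  rw [e2]
  have := mul_le_mul_of_nonneg_left key hc0.le
  linarith

/-- order three automorphism -/
def rotT : ℤ × ℤ ≃ ℤ × ℤ where
  toFun p := (-p.2, p.1 - p.2)
  invFun p := (p.2 - p.1, -p.1)
  left_inv p := by ext <;> simp
  right_inv p := by ext <;> simp

def nrm (p : ℤ × ℤ) : ℤ := p.1^2 - p.1*p.2 + p.2^2

theorem nrm_rotT (p : ℤ × ℤ) : nrm (rotT p) = nrm p := by
  simp only [nrm, rotT, Equiv.coe_fn_mk]; ring

theorem qf_hex (p : ℤ × ℤ) : qf (-1/2) (√3/2) p = 2/√3 * nrm p := by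
  have h3 : √3 ^ 2 = (3:ℝ) := Real.sq_sqrt (by norm_num)
  have : (0:ℝ) < √3 := by positivity
  simp only [qf, nrm]
  push_cast
  field_simp
  nlinarith

/-- tail weight -/
noncomputable def gw (m : ℤ) : ℝ := (1/16 : ℝ) ^ (m.natAbs - 2)

theorem gw_nonneg (m : ℤ) : 0 ≤ gw m := by unfold gw; positivity

theorem hasSum_gw : HasSum gw (77/15) := by
  have h0 : HasSum (fun n : ℕ => (1/16:ℝ)^n) (16/15) := by
    have := hasSum_geometric_of_lt_one (r := (1/16:ℝ)) (by norm_num) (by norm_num)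
    norm_num at this ⊢; exact this
  have h1 : HasSum (fun n : ℕ => gw (n:ℤ)) (16/15 + 2) := by
    rw [← hasSum_nat_add_iff' 2] 
    have e : ∀ n : ℕ, gw (((n + 2 : ℕ):ℤ)) = (1/16:ℝ)^n := by
      intro n
      simp only [gw]
      congr 1
    simp only [e]
    have hs : 16/15 + 2 - ∑ i ∈ Finset.range 2, gw ((i:ℕ):ℤ) = 16/15 := by
      simp [Finset.sum_range_succ, gw]; norm_num
    rw [hs]; exact h0
  have h2 : HasSum (fun n : ℕ => gw (-((n:ℤ)+1))) (16/15 + 1) := by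
    rw [← hasSum_nat_add_iff' 1] 
    have e : ∀ n : ℕ, gw (-(((n + 1 : ℕ):ℤ)+1)) = (1/16:ℝ)^n := by
      intro n
      simp only [gw]
      congr 1
    simp only [e]
    have hs : 16/15 + 1 - ∑ i ∈ Finset.range 1, gw (-(((i:ℕ):ℤ)+1)) = 16/15 := by
      simp [Finset.sum_range_succ, gw]
    rw [hs]; exact h0
  have := h1.of_nat_of_neg_add_one h2
  norm_num at this
  exact this

theorem nrm_lower (p : ℤ × ℤ) (h : 3 ≤ nrm p) :
    ((p.1.natAbs - 2 : ℕ):ℤ) + ((p.2.natAbs - 2 : ℕ) : ℤ) + 3 ≤ nrm p := by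
  obtain ⟨m, n⟩ := p
  simp only [nrm] at *
  have am := Int.natCast_natAbs m
  have an := Int.natCast_natAbs n
  rcases le_or_gt m.natAbs 2 with hm | hm <;> rcases le_or_gt n.natAbs 2 with hn | hn
  · have : m.natAbs - 2 = 0 := by omega
    have : n.natAbs - 2 = 0 := by omega
    simp_all
  · have e1 : m.natAbs - 2 = 0 := by omega
    rw [e1]
    have h1 : ((n.natAbs - 2 : ℕ) : ℤ) = |n| - 2 := by omega
    rw [h1]
    have h2 : (3:ℤ) ≤ |n| := by omega
    push_cast
    nlinarith [sq_nonneg (2*m-n), sq_abs n]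
  · have e1 : n.natAbs - 2 = 0 := by omega
    rw [e1]
    have h1 : ((m.natAbs - 2 : ℕ) : ℤ) = |m| - 2 := by omega
    rw [h1]
    have h2 : (3:ℤ) ≤ |m| := by omega
    push_cast
    nlinarith [sq_nonneg (2*n-m), sq_abs m]
  · have h1 : ((m.natAbs - 2 : ℕ) : ℤ) = |m| - 2 := by omega
    have h1' : ((n.natAbs - 2 : ℕ) : ℤ) = |n| - 2 := by omega
    rw [h1, h1']
    have h2 : (3:ℤ) ≤ |m| := by omega
    have h2 : (3:ℤ) ≤ |n| := by omega
    nlinarith [sq_nonneg (n-m), sq_abs m, sq_abs n]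

/-- the six minimal vectors -/
def hexH : Finset (ℤ × ℤ) := {(1,0), (0,1), (-1,-1), (-1,0), (0,-1), (1,1)}

theorem nrm_cases (p : ℤ × ℤ) : p = 0 ∨ p ∈ hexH ∨ 3 ≤ nrm p := by
  obtain ⟨m, n⟩ := p
  by_cases h : 3 ≤ nrm (m,n)
  · right; right; exact h
  · simp only [nrm, not_le] at h
    have hm : m^2 < 4 := by nlinarith [sq_nonneg (2*n-m)]
    have hn : n^2 < 4 := by nlinarith [sq_nonneg (2*m-n)]
    have h1 : -2 < m := by nlinarith
    have h2 : m < 2 := by nlinarith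
    have h3 : -2 < n := by nlinarith
    have h4 : n < 2 := by nlinarith
    interval_cases m <;> interval_cases n <;> simp_all [hexH, nrm]

theorem tail_term (b : ℝ) (hb : 32 ≤ Real.exp b) (p : ℤ × ℤ) (h : 3 ≤ nrm p) :
    (nrm p : ℝ) * Real.exp (-(b * nrm p)) ≤ Real.exp (-b) * (3/1024 * (gw p.1 * gw p.2)) := by
  have hl := nrm_lower p h
  obtain ⟨k, hk⟩ : ∃ k : ℕ, nrm p = 3 + k := ⟨(nrm p - 3).toNat, by omega⟩
  have hk2 : (p.1.natAbs - 2) + (p.2.natAbs - 2) ≤ k := by omega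
  have hg : (1/16:ℝ)^k ≤ gw p.1 * gw p.2 := by
    rw [gw, gw, ← pow_add]
    exact pow_le_pow_of_le_one (by norm_num) (by norm_num) hk2
  have he : Real.exp (-b) ≤ 1/32 := by
    rw [Real.exp_neg, inv_eq_one_div]; exact one_div_le_one_div_of_le (by norm_num) hb
  have e0 := Real.exp_pos (-b)
  have e1 : Real.exp (-(b * nrm p)) = Real.exp (-b) * Real.exp (-b)^2 * Real.exp (-b)^k := by
    rw [hk, ← pow_succ', ← pow_add, ← Real.exp_nat_mul]; congr 1; push_cast; ring
  have h2 : (3 + k : ℝ) ≤ 3 * 2^k := by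
    have := Nat.lt_two_pow_self (n := k)
    have h' : (k + 1 : ℝ) ≤ 2^k := by exact_mod_cast this
    have : (0:ℝ) ≤ k := by positivity
    linarith
  have h3 : Real.exp (-b)^2 ≤ (1/32)^2 := by gcongr
  have h4 : Real.exp (-b)^k ≤ (1/32)^k := by gcongr
  have e2 : (nrm p : ℝ) = 3 + k := by rw [hk]; push_cast; ring
  calc (nrm p : ℝ) * Real.exp (-(b * nrm p)) = (3+k) * (Real.exp (-b) * Real.exp (-b)^2 * Real.exp (-b)^k) := by rw [e1, e2]
    _ ≤ (3 * 2^k) * (Real.exp (-b) * (1/32)^2 * (1/32)^k) := by gcongr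
    _ = Real.exp (-b) * (3/1024 * (1/16)^k) := by
        have : (1/16:ℝ)^k = 2^k * (1/32)^k := by rw [← mul_pow]; norm_num
        rw [this]; ring
    _ ≤ _ := by gcongr

theorem exp_avg (u v w : ℝ) : 3 * Real.exp ((u+v+w)/3) ≤ Real.exp u + Real.exp v + Real.exp w := by
  set μ := (u+v+w)/3 with hμ
  have e : ∀ t : ℝ, Real.exp μ * (1 + (t - μ)) ≤ Real.exp t := by
    intro t
    have := Real.add_one_le_exp (t-μ)
    have h2 : Real.exp t = Real.exp μ * Real.exp (t-μ) := by rw [← Real.exp_add]; congr 1; ring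
    rw [h2]; gcongr; linarith
  have := e u; have := e v; have := e w
  have e3 : u + v + w = 3*μ := by rw [hμ]; ring
  have e4 : Real.exp μ * (1 + (u - μ)) + Real.exp μ * (1 + (v - μ)) + Real.exp μ * (1 + (w - μ)) = 3 * Real.exp μ := by
    linear_combination Real.exp μ * e3
  linarith

set_option maxHeartbeats 2000000 in
theorem main1 (β x y : ℝ) (hβ : Real.pi ≤ β) (hx0 : -1/2 ≤ x) (hx1 : x ≤ 0) (hy : √3/2 ≤ y)
    (hne : ¬ (x = -1/2 ∧ y = √3/2)) :
    theta β (-1/2) (√3/2) < theta β x y := by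
  have h3 : √3 ^ 2 = (3:ℝ) := Real.sq_sqrt (by norm_num)
  have h30 : (0:ℝ) < √3 := by positivity
  have hpi := Real.pi_gt_d4
  have hβ0 : 0 < β := by linarith
  have hy0 : 0 < y := by linarith
  have h31 : √3 < 1.7321 := by nlinarith
  obtain ⟨b, hb⟩ : ∃ b, b = 2*β/√3 := ⟨_, rfl⟩
  obtain ⟨B, hB⟩ : ∃ B, B = β/y := ⟨_, rfl⟩
  obtain ⟨z, hz⟩ : ∃ z, z = 1/2 + x := ⟨_, rfl⟩
  have hb1 : 3627/1000 ≤ b := by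
    rw [hb, le_div_iff₀ h30]; nlinarith
  have hB0 : 0 < B := by rw [hB]; positivity
  have hBb : B ≤ b := by
    rw [hb, hB, div_le_div_iff₀ hy0 h30]; nlinarith
  have hz0 : 0 ≤ z := by linarith
  have hz1 : z ≤ 1/2 := by linarith
  have hbe : 32 ≤ Real.exp b := by
    have h1 := exp_lower6 (3627/1000) (by norm_num)
    have h2 : Real.exp (3627/1000) ≤ Real.exp b := Real.exp_le_exp.2 hb1
    have h3 : (32:ℝ) ≤ 1 + (3627/1000) + (3627/1000)^2/2 + (3627/1000)^3/6 + (3627/1000)^4/24 + (3627/1000)^5/120 + (3627/1000)^6/720 := by norm_num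
    linarith
  have hG := Gamma_bound b B z hb1 hB0 hBb hz0 hz1
  obtain ⟨C, hC⟩ : ∃ C, C = (b-B)^2/(2*B) + 2/3*(B*z^2) := ⟨_, rfl⟩
  rw [← hC] at hG
  have hyB : y = √3 * b / (2 * B) := by
    rw [hb, hB]; field_simp
  have hC0 : 0 < C := by
    have hA1 : 0 ≤ (b-B)^2/(2*B) := by positivity
    have hA2 : 0 ≤ 2/3*(B*z^2) := by positivity
    rcases (add_nonneg hA1 hA2).lt_or_eq with h | h
    · rw [hC]; exact h
    · exfalso
      have e1 : (b-B)^2/(2*B) = 0 := by linarith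
      have e2 : 2/3*(B*z^2) = 0 := by linarith
      have e3 : z = 0 := by
        have : B ≠ 0 := hB0.ne'
        simpa [this] using e2
      have e4 : b - B = 0 := by
        have : B ≠ 0 := hB0.ne'
        simpa [this] using e1
      apply hne
      constructor
      · linarith
      · have : b = B := by linarith
        rw [hyB, this]; field_simp
  obtain ⟨M, hM⟩ : ∃ M, M = min 1 C := ⟨_, rfl⟩
  rw [← hM] at hG
  have hM0 : 0 < M := by rw [hM]; exact lt_min one_pos hC0
  -- identity for C
  have hCσ : ∀ N : ℝ, 2*β*((1+x+x^2+y^2)/y)*N/3 = N*(b + C) := by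
    intro N
    have hβB : β = √3*b/2 := by rw [hb]; field_simp
    have hxz : x = z - 1/2 := by linarith
    have : (1+x+x^2+y^2)/y * (2*β) = 3*(b + C) := by
      have e1 : (1+x+x^2+y^2)/y * (2*β) = 2*B*(1+x+x^2) + 2*(β*y) := by
        rw [hB]; field_simp
      have e2 : β * y = 3*b^2/(4*B) := by
        rw [hyB, hβB]; field_simp; rw [h3]; try norm_num
      rw [e1, e2, hxz, hC]
      field_simp
      ring
    linear_combination (N/3) * this
  set d : ℤ × ℤ → ℝ := fun p => Real.exp (-(β * qf x y p)) - Real.exp (-(β * qf (-1/2) (√3/2) p)) with hd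
  have hs1 := summable_theta β x y hβ0 hy0
  have hs2 := summable_theta β (-1/2) (√3/2) hβ0 (by positivity)
  have hsd : Summable d := hs1.sub hs2
  have hsum : ∑' p, d p = theta β x y - theta β (-1/2) (√3/2) := hs1.tsum_sub hs2
  have hhex : ∀ p, β * qf (-1/2) (√3/2) p = b * nrm p := by
    intro p; rw [qf_hex, hb]; ring
  -- averaged
  set D : ℤ × ℤ → ℝ := fun p => (d p + d (rotT p) + d (rotT (rotT p)))/3 with hD
  have hsT : Summable (fun p => d (rotT p)) := rotT.summable_iff.2 hsd
  have hsTT : Summable (fun p => d (rotT (rotT p))) := rotT.summable_iff (f := fun p => d (rotT p)) |>.2 hsT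
  have hsD : Summable D := ((hsd.add hsT).add hsTT).div_const 3
  have hsumD : ∑' p, D p = ∑' p, d p := by
    have e1 : ∑' p, d (rotT p) = ∑' p, d p := rotT.tsum_eq d
    have e2 : ∑' p, d (rotT (rotT p)) = ∑' p, d p := by
      rw [← e1]; exact rotT.tsum_eq (fun p => d (rotT p))
    rw [hD, tsum_div_const, (hsd.add hsT).tsum_add hsTT, hsd.tsum_add hsT, e1, e2]; ring
  have hDeq : ∀ p, D p = (Real.exp (-(β * qf x y p)) + Real.exp (-(β * qf x y (rotT p))) + Real.exp (-(β * qf x y (rotT (rotT p)))))/3 - Real.exp (-(b * nrm p)) := by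
    intro p
    simp only [hD, hd, hhex, nrm_rotT]; ring
  have hDtail : ∀ p, 3 ≤ nrm p → -(M * (nrm p * Real.exp (-(b * nrm p)))) ≤ D p := by
    intro p hp
    have hN : (3:ℝ) ≤ nrm p := by exact_mod_cast hp
    obtain ⟨N, hNd⟩ : ∃ N : ℝ, N = nrm p := ⟨_, rfl⟩
    have h1 := exp_avg (-(β * qf x y p)) (-(β * qf x y (rotT p))) (-(β * qf x y (rotT (rotT p))))
    have h2 : (-(β * qf x y p) + -(β * qf x y (rotT p)) + -(β * qf x y (rotT (rotT p))))/3 = -(N*(b+C)) := by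
      rw [← hCσ, hNd]
      simp only [qf, rotT, nrm, Equiv.coe_fn_mk]
      push_cast
      field_simp
      ring
    rw [h2] at h1
    rw [hDeq]
    rw [← hNd] at hN ⊢
    have h4 : Real.exp (-(N*(b+C))) = Real.exp (-(b*N)) * Real.exp (-(N*C)) := by
      rw [← Real.exp_add]; congr 1; ring
    have h5 : 1 - N * M ≤ Real.exp (-(N*C)) := by
      rcases le_total 1 C with h | h
      · have : M = 1 := by rw [hM, min_eq_left h]
        have := Real.exp_pos (-(N*C))
        nlinarith
      · have e : M = C := by rw [hM, min_eq_right h]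
        have := Real.add_one_le_exp (-(N*C))
        rw [e]; linarith
    have h6 := mul_le_mul_of_nonneg_left h5 (Real.exp_pos (-(b*N))).le
    rw [h4] at h1
    linarith
  have hDH : ∀ p ∈ hexH, Real.exp (-b) * M * (4/300) ≤ D p := by
    have hq1 : β * qf x y (1,0) = B := by
      simp only [qf, hB]; push_cast; ring
    have hβy : β / y = B := hB.symm
    have hβB : β = √3*b/2 := by rw [hb]; field_simp
    have e2 : β * y = 3*b^2/(4*B) := by
      rw [hyB, hβB]; field_simp; rw [h3]; try norm_num
    have hxz : x = z - 1/2 := by linarith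
    have hq2 : β * qf x y (0,1) = b + (b-B)*(3*b-B)/(4*B) + B*z^2 - B*z := by
      have : β * qf x y (0,1) = B*x^2 + β*y := by
        simp only [qf, hB]; push_cast; field_simp; try ring
      rw [this, e2, hxz]; field_simp; ring
    have hq3 : β * qf x y (1,1) = b + (b-B)*(3*b-B)/(4*B) + B*z^2 + B*z := by
      have : β * qf x y (1,1) = B*(1+x)^2 + β*y := by
        simp only [qf, hB]; push_cast; field_simp; try ring
      rw [this, e2, hxz]; field_simp; try ring
    have hneg : ∀ m n : ℤ, qf x y (-m,-n) = qf x y (m,n) := by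
      intro m n; simp only [qf]; push_cast; ring
    have hq1' : β * qf x y (-1,0) = B := by
      have := hneg 1 0; rw [← hq1, ← this]; try rfl
    have hq2' : β * qf x y (0,-1) = b + (b-B)*(3*b-B)/(4*B) + B*z^2 - B*z := by
      have := hneg 0 1; rw [← hq2, ← this]; try rfl
    have hq3' : β * qf x y (-1,-1) = b + (b-B)*(3*b-B)/(4*B) + B*z^2 + B*z := by
      have := hneg 1 1; rw [← hq3, ← this]
    have x1 : Real.exp (-B) = Real.exp (-b) * Real.exp (b-B) := by
      rw [← Real.exp_add]; congr 1; ring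
    obtain ⟨a, ha⟩ : ∃ a, a = (b-B)*(3*b-B)/(4*B) := ⟨_, rfl⟩
    rw [← ha] at hq2 hq3 hq2' hq3' hG
    have x2 : Real.exp (-(b + a + B*z^2 - B*z)) = Real.exp (-b) * (Real.exp (-a) * (Real.exp (-(B*z^2)) * Real.exp (B*z))) := by
      rw [← Real.exp_add, ← Real.exp_add, ← Real.exp_add]; congr 1; ring
    have x3 : Real.exp (-(b + a + B*z^2 + B*z)) = Real.exp (-b) * (Real.exp (-a) * (Real.exp (-(B*z^2)) * Real.exp (-(B*z)))) := by
      rw [← Real.exp_add, ← Real.exp_add, ← Real.exp_add]; congr 1; ring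
    have fin : Real.exp (-b) * M * (4/300) ≤ (Real.exp (-B) + Real.exp (-(b + a + B*z^2 - B*z)) + Real.exp (-(b + a + B*z^2 + B*z)))/3 - Real.exp (-b) := by
      rw [x1, x2, x3]
      rw [Real.cosh_eq] at hG
      have := mul_le_mul_of_nonneg_left hG (Real.exp_pos (-b)).le
      linarith
    intro p hp
    rw [hDeq]
    simp only [hexH, Finset.mem_insert, Finset.mem_singleton] at hp
    have r1 : rotT (1,0) = (0,1) := rfl
    have r2 : rotT (0,1) = (-1,-1) := rfl
    have r3 : rotT (-1,-1) = (1,0) := rfl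
    have r4 : rotT (-1,0) = (0,-1) := rfl
    have r5 : rotT (0,-1) = (1,1) := rfl
    have r6 : rotT (1,1) = (-1,0) := rfl
    have n1 : nrm (1,0) = 1 := rfl
    have n2 : nrm (0,1) = 1 := rfl
    have n3 : nrm (-1,-1) = 1 := rfl
    have n4 : nrm (-1,0) = 1 := rfl
    have n5 : nrm (0,-1) = 1 := rfl
    have n6 : nrm (1,1) = 1 := rfl
    rcases hp with rfl | rfl | rfl | rfl | rfl | rfl
    · rw [r1, r2, n1, hq1, hq2, hq3', Int.cast_one, mul_one]; linarith
    · rw [r2, r3, n2, hq1, hq2, hq3', Int.cast_one, mul_one]; linarith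
    · rw [r3, r1, n3, hq1, hq2, hq3', Int.cast_one, mul_one]; linarith
    · rw [r4, r5, n4, hq1', hq2', hq3, Int.cast_one, mul_one]; linarith
    · rw [r5, r6, n5, hq1', hq2', hq3, Int.cast_one, mul_one]; linarith
    · rw [r6, r4, n6, hq1', hq2', hq3, Int.cast_one, mul_one]; linarith
  -- lower bound function
  obtain ⟨E, hE⟩ : ∃ E, E = Real.exp (-b) * M := ⟨_, rfl⟩
  have hE0 : 0 < E := by rw [hE]; positivity
  have hgg : HasSum (fun p : ℤ × ℤ => gw p.1 * gw p.2) (77/15 * (77/15)) := by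
    have hs : Summable (fun p : ℤ × ℤ => gw p.1 * gw p.2) :=
      hasSum_gw.summable.mul_of_nonneg hasSum_gw.summable gw_nonneg gw_nonneg
    exact hasSum_gw.mul hasSum_gw hs
  have hind : HasSum (fun p : ℤ × ℤ => if p ∈ hexH then (4/300:ℝ) else 0) (6 * (4/300)) := by
    have := hasSum_sum_of_ne_finset_zero (L := SummationFilter.unconditional (ℤ × ℤ)) (f := fun p : ℤ × ℤ => if p ∈ hexH then (4/300:ℝ) else 0) (s := hexH)
      (fun p hp => by simp [hp])
    convert this using 1
    rw [Finset.sum_ite_mem, Finset.inter_self, Finset.sum_const]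
    have : hexH.card = 6 := by decide
    rw [this]; norm_num
  have hL := (hind.sub (hgg.mul_left (3/1024))).mul_left E
  have hle : ∀ p, E * ((if p ∈ hexH then (4/300:ℝ) else 0) - 3/1024 * (gw p.1 * gw p.2)) ≤ D p := by
    intro p
    have hg0 : 0 ≤ gw p.1 * gw p.2 := mul_nonneg (gw_nonneg _) (gw_nonneg _)
    have hEg : 0 ≤ E * (3/1024 * (gw p.1 * gw p.2)) := by positivity
    by_cases hpH : p ∈ hexH
    · have := hDH p hpH
      rw [← hE] at this
      rw [if_pos hpH]
      linarith
    · rw [if_neg hpH]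
      rcases nrm_cases p with h | h | h
      · subst h
        have : D 0 = 0 := by
          rw [hDeq]; norm_num [rotT, nrm, qf]
        rw [this]; linarith
      · exact absurd h hpH
      · have h1 := hDtail p h
        have h2 := tail_term b hbe p h
        have h3 := mul_le_mul_of_nonneg_left h2 hM0.le
        rw [hE]
        linarith
  have hfin := hasSum_le hle hL hsD.hasSum
  rw [hsumD, hsum] at hfin
  have : 0 < E * (6 * (4/300) - 3/1024 * (77/15 * (77/15))) := by
    apply mul_pos hE0; norm_num
  linarith

theorem theta_fiber (α x y : ℝ) (hα : 0 < α) (hy : 0 < y) :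
    theta (Real.pi * α) x y = ∑' n : ℤ, Real.exp (-Real.pi * n^2 * (α*y)) *
      HurwitzZeta.evenKernel (((n:ℝ)*x : ℝ) : UnitAddCircle) (α/y) := by
  have hs := summable_theta (Real.pi*α) x y (by have := Real.pi_pos; positivity) hy
  have hs' : Summable (fun q : ℤ × ℤ => Real.exp (-(Real.pi * α * qf x y (q.2, q.1)))) :=
    (Equiv.prodComm ℤ ℤ).summable_iff.2 hs
  have e : theta (Real.pi * α) x y = ∑' q : ℤ × ℤ, Real.exp (-(Real.pi * α * qf x y (q.2, q.1))) :=
    ((Equiv.prodComm ℤ ℤ).tsum_eq (fun p => Real.exp (-(Real.pi * α * qf x y p)))).symm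
  rw [e, hs'.tsum_prod]
  congr 1
  ext n
  have h := (HurwitzZeta.hasSum_int_evenKernel ((n:ℝ)*x) (t := α/y) (by positivity)).mul_left
    (Real.exp (-Real.pi * n^2 * (α*y)))
  rw [← h.tsum_eq]
  congr 1
  ext m
  rw [← Real.exp_add]
  congr 1
  simp only [qf]
  field_simp
  ring

noncomputable def Fdual (α x y : ℝ) (p : ℤ × ℤ) : ℂ :=
  Complex.exp (2*Real.pi*Complex.I*((p.1:ℝ)*x : ℝ)*p.2) *
    (Real.exp (-Real.pi * p.1^2 * (α*y)) * Real.exp (-Real.pi*p.2^2*(1/(α/y))) : ℝ)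

theorem summable_Fdual (α x y : ℝ) (hα : 0 < α) (hy : 0 < y) : Summable (Fdual α x y) := by
  have hpi := Real.pi_pos
  have h1 := summable_gauss1 (Real.pi*(α*y)) (by positivity)
  have h2 := summable_gauss1 (Real.pi*(1/(α/y))) (by positivity)
  have h3 := h1.mul_of_nonneg h2 (fun _ => (Real.exp_pos _).le) (fun _ => (Real.exp_pos _).le)
  refine Summable.of_norm ?_
  refine h3.congr (fun p => ?_)
  rw [Fdual, norm_mul, Complex.norm_real, Real.norm_of_nonneg (by positivity)]
  have : ‖Complex.exp (2*Real.pi*Complex.I*((p.1:ℝ)*x : ℝ)*p.2)‖ = 1 := by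
    have : (2*Real.pi*Complex.I*((p.1:ℝ)*x : ℝ)*p.2 : ℂ) = ((2*Real.pi*((p.1:ℝ)*x)*p.2 : ℝ):ℂ) * Complex.I := by
      push_cast; ring
    rw [this, Complex.norm_exp_ofReal_mul_I]
  rw [this, one_mul]
  congr 2 <;> ring

theorem theta_dual (α x y : ℝ) (hα : 0 < α) (hy : 0 < y) :
    (theta (Real.pi * α) x y : ℂ) = ((1/(α/y)^(1/2:ℝ) : ℝ) : ℂ) * ∑' p, Fdual α x y p := by
  rw [theta_fiber α x y hα hy, (summable_Fdual α x y hα hy).tsum_prod, Complex.ofReal_tsum, ← tsum_mul_left]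
  congr 1
  ext n
  rw [HurwitzZeta.evenKernel_functional_equation]
  have h := (HurwitzZeta.hasSum_int_cosKernel ((n:ℝ)*x) (t := 1/(α/y)) (by positivity)).mul_left
    ((Real.exp (-Real.pi * n^2 * (α*y)) : ℝ) : ℂ)
  have e : ∑' k, Fdual α x y (n, k) = ((Real.exp (-Real.pi * n^2 * (α*y)) : ℝ) : ℂ) * (HurwitzZeta.cosKernel (((n:ℝ)*x : ℝ) : UnitAddCircle) (1/(α/y)) : ℝ) := by
    rw [← h.tsum_eq]
    congr 1
    ext k
    simp only [Fdual]
    push_cast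
    ring
  rw [e]
  push_cast
  ring

theorem theta_poisson (α x y : ℝ) (hα : 0 < α) (hy : 0 < y) :
    theta (Real.pi * α) x y = 1/α * theta (Real.pi * (1/α)) x y := by
  have h1 := theta_dual α x y hα hy
  have h2 := theta_dual (1/α) x y (by positivity) hy
  have e : ∑' p, Fdual (1/α) x y p = ∑' p, Fdual α x y p := by
    rw [← (Equiv.prodComm ℤ ℤ).tsum_eq (Fdual α x y)]
    congr 1
    ext p
    simp only [Fdual, Equiv.prodComm_apply, Prod.fst_swap, Prod.snd_swap]
    congr 1
    · congr 1
      push_cast; ring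
    · congr 1
      rw [mul_comm]
      congr 2 <;> field_simp
  rw [e] at h2
  have e3 : (1/(α/y)^(1/2:ℝ) : ℝ) = 1/α * (1/((1/α)/y)^(1/2:ℝ)) := by
    rw [← Real.sqrt_eq_rpow, ← Real.sqrt_eq_rpow, Real.sqrt_div (by positivity), Real.sqrt_div (by positivity),
      Real.sqrt_div (by positivity), Real.sqrt_one]
    have : α = √α^2 := (Real.sq_sqrt hα.le).symm
    have h0 : 0 < √α := by positivity
    have h0 : 0 < √y := by positivity
    nth_rw 2 [this]
    field_simp
  rw [e3] at h1
  have : (theta (Real.pi * α) x y : ℂ) = ((1/α * theta (Real.pi * (1/α)) x y : ℝ) : ℂ) := by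
    rw [h1]
    push_cast
    rw [h2]
    push_cast
    ring
  exact_mod_cast this

theorem main2 (β x y : ℝ) (hβ : 0 < β) (hx0 : -1/2 ≤ x) (hx1 : x ≤ 0) (hy : √3/2 ≤ y)
    (hne : ¬ (x = -1/2 ∧ y = √3/2)) :
    theta β (-1/2) (√3/2) < theta β x y := by
  have hpi := Real.pi_pos
  have hs : (0:ℝ) < √3/2 := by positivity
  rcases le_total Real.pi β with h | h
  · exact main1 β x y h hx0 hx1 hy hne
  · obtain ⟨α, hα⟩ : ∃ α, α = β/Real.pi := ⟨_, rfl⟩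
    have hα0 : 0 < α := by rw [hα]; positivity
    have hα1 : α ≤ 1 := by rw [hα, div_le_one hpi]; exact h
    have e : β = Real.pi * α := by rw [hα]; field_simp
    rw [e, theta_poisson α x y hα0 (by linarith), theta_poisson α _ _ hα0 hs]
    have h1 : 1 ≤ 1/α := by rw [le_div_iff₀ hα0]; linarith
    exact mul_lt_mul_of_pos_left (main1 _ x y (by nlinarith) hx0 hx1 hy hne) (by positivity)

def intEquiv (a b c d : ℤ) (h : (a*d-b*c)*(a*d-b*c) = 1) : ℤ × ℤ ≃ ℤ × ℤ where
  toFun p := (a*p.1 + b*p.2, c*p.1 + d*p.2)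
  invFun p := ((a*d-b*c)*(d*p.1 - b*p.2), (a*d-b*c)*(-c*p.1 + a*p.2))
  left_inv p := by
    ext
    · simp only; linear_combination p.1 * h
    · simp only; linear_combination p.2 * h
  right_inv p := by
    ext
    · simp only; linear_combination p.1 * h
    · simp only; linear_combination p.2 * h

theorem qf_eq_normSq (z : UpperHalfPlane) (m n : ℤ) :
    qf z.re z.im (m,n) = Complex.normSq ((m:ℂ) + n * (z:ℂ)) / z.im := by
  rw [Complex.normSq_apply]
  simp [qf]
  ring

open scoped Modular in
theorem reduce1 (x y : ℝ) (hy : 0 < y) : ∃ a b c d : ℤ, a*d-b*c = 1 ∧ ∃ x' y' : ℝ,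
    |x'| ≤ 1/2 ∧ √3/2 ≤ y' ∧ ∀ m n : ℤ, qf x y (a*m+b*n, c*m+d*n) = qf x' y' (m,n) := by
  let z : UpperHalfPlane := ⟨⟨x, y⟩, hy⟩
  obtain ⟨g, hg⟩ := ModularGroup.exists_smul_mem_fd z
  have hdet := g.det_coe
  rw [Matrix.det_fin_two] at hdet
  have hdet : g 0 0 * g 1 1 - g 0 1 * g 1 0 = 1 := hdet
  refine ⟨g 1 1, g 0 1, g 1 0, g 0 0, by linarith, (g • z).re, (g • z).im, hg.2, ?_, ?_⟩
  · have h := ModularGroup.three_le_four_mul_im_sq_of_mem_fd hg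
    have h0 := (g • z).im_pos
    have h3 : √3 ^ 2 = (3:ℝ) := Real.sq_sqrt (by norm_num)
    have h30 : (0:ℝ) < √3 := by positivity
    nlinarith
  · intro m n
    have e : qf x y = qf z.re z.im := rfl
    rw [e, qf_eq_normSq, qf_eq_normSq, ModularGroup.im_smul_eq_div_normSq, UpperHalfPlane.coe_specialLinearGroup_apply]
    have hd0 : UpperHalfPlane.denom g z ≠ 0 := UpperHalfPlane.denom_ne_zero _ _
    have hd := ModularGroup.denom_apply g z
    rw [hd] at hd0 ⊢
    have : (m:ℂ) + n * (((algebraMap ℤ ℝ (g 0 0) : ℝ) * (z:ℂ) + (algebraMap ℤ ℝ (g 0 1) : ℝ)) / ((algebraMap ℤ ℝ (g 1 0) : ℝ) * (z:ℂ) + (algebraMap ℤ ℝ (g 1 1) : ℝ)))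
       = ((((g 1 1) * m + (g 0 1) * n : ℤ):ℂ) + ((g 1 0 * m + g 0 0 * n : ℤ):ℂ) * z) / ((g 1 0 : ℂ) * z + (g 1 1:ℂ)) := by
      simp only [eq_intCast, Complex.ofReal_intCast]
      rw [eq_div_iff hd0, add_mul, mul_assoc, div_mul_cancel₀ _ hd0]
      push_cast
      ring
    rw [this, map_div₀]
    have hy0 := z.im_pos
    have : 0 < Complex.normSq ((g 1 0 : ℂ) * z + (g 1 1:ℂ)) := Complex.normSq_pos.2 hd0
    generalize Complex.normSq ((g 1 0 : ℂ) * z + (g 1 1:ℂ)) = N at this ⊢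
    field_simp

theorem reduce2 (x y : ℝ) (hy : 0 < y) : ∃ a b c d : ℤ, (a*d-b*c = 1 ∨ a*d-b*c = -1) ∧ ∃ x' y' : ℝ,
    -1/2 ≤ x' ∧ x' ≤ 0 ∧ √3/2 ≤ y' ∧ ∀ m n : ℤ, qf x y (a*m+b*n, c*m+d*n) = qf x' y' (m,n) := by
  obtain ⟨a, b, c, d, h, x', y', hx, hy', hq⟩ := reduce1 x y hy
  rw [abs_le] at hx
  rcases le_total x' 0 with h0 | h0
  · exact ⟨a, b, c, d, Or.inl h, x', y', by linarith [hx.1], h0, hy', hq⟩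
  · refine ⟨a, -b, c, -d, Or.inr (by linarith), -x', y', by linarith [hx.2], by linarith, hy', ?_⟩
    intro m n
    have := hq m (-n)
    have e : qf x' y' (m, -n) = qf (-x') y' (m, n) := by
      simp only [qf]; push_cast; ring
    rw [← e, ← this]
    congr 2 <;> ring

theorem theta_reindex (β x y x' y' : ℝ) (a b c d : ℤ) (h : a*d-b*c = 1 ∨ a*d-b*c = -1)
    (hq : ∀ m n : ℤ, qf x y (a*m+b*n, c*m+d*n) = qf x' y' (m,n)) : theta β x y = theta β x' y' := by
  have h' : (a*d-b*c)*(a*d-b*c) = 1 := by rcases h with h | h <;> rw [h] <;> norm_num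
  unfold theta
  rw [← (intEquiv a b c d h').tsum_eq]
  congr 1
  ext p
  have := hq p.1 p.2
  simp only [intEquiv, Equiv.coe_fn_mk]
  rw [this]

theorem hex_or_lt (x y : ℝ) (hy : 0 < y) : (∀ β : ℝ, 0 < β → theta β (-1/2) (√3/2) < theta β x y) ∨
    ∃ a b c d : ℤ, a*d-b*c = 1 ∧ ∀ m n : ℤ, qf x y (a*m+b*n, c*m+d*n) = 2/√3*((m:ℝ)^2+m*n+n^2) := by
  obtain ⟨a, b, c, d, h, x', y', hx1, hx0, hy', hq⟩ := reduce2 x y hy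
  by_cases hc : x' = -1/2 ∧ y' = √3/2
  · right
    obtain ⟨rfl, rfl⟩ := hc
    rcases h with h | h
    · refine ⟨b, -a, d, -c, by linarith, fun m n => ?_⟩
      have := hq (-n) m
      rw [qf_hex] at this
      simp only [nrm] at this
      push_cast at this
      rw [show b*m + -a*n = a*(-n) + b*m by ring, show d*m + -c*n = c*(-n)+d*m by ring, this]
      ring
    · refine ⟨a, -b, c, -d, by linarith, fun m n => ?_⟩
      have := hq m (-n)
      rw [qf_hex] at this
      simp only [nrm] at this
      push_cast at this
      rw [show a*m + -b*n = a*m + b*(-n) by ring, show c*m + -d*n = c*m+d*(-n) by ring, this]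
      ring
  · left
    intro β hβ
    rw [theta_reindex β x y x' y' a b c d h hq]
    exact main2 β x' y' hβ hx1 hx0 hy' hc

noncomputable def Gf (x : ℝ) : ℝ := ∫ v in (0:ℝ)..x, Real.exp (-1 * v^2)

theorem Gf_deriv (x : ℝ) : HasDerivAt Gf (Real.exp (-1 * x^2)) x := by
  have hc : Continuous (fun v : ℝ => Real.exp (-1 * v^2)) := by fun_prop
  exact intervalIntegral.integral_hasDerivAt_right (hc.intervalIntegrable _ _)
    hc.aestronglyMeasurable.stronglyMeasurableAtFilter hc.continuousAt

theorem Gf_top : Filter.Tendsto Gf Filter.atTop (nhds (√Real.pi/2)) := by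
  have h := MeasureTheory.intervalIntegral_tendsto_integral_Ioi (f := fun v : ℝ => Real.exp (-1 * v^2)) 0
    (integrable_exp_neg_mul_sq one_pos).integrableOn (Filter.tendsto_id (α := ℝ) (x := Filter.atTop))
  rw [integral_gaussian_Ioi 1, div_one] at h
  exact h

theorem Gf_neg (x : ℝ) : Gf (-x) = - Gf x := by
  unfold Gf
  have h := intervalIntegral.integral_comp_neg (a := 0) (b := x) (fun v : ℝ => Real.exp (-1 * v^2))
  simp only [neg_sq, neg_zero] at h
  rw [h, intervalIntegral.integral_symm]

theorem Gf_bot : Filter.Tendsto Gf Filter.atBot (nhds (-(√Real.pi/2))) := by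
  have h := (Gf_top.comp Filter.tendsto_neg_atBot_atTop).neg
  refine h.congr (fun x => ?_)
  simp [Gf_neg]

theorem subord_real (a r : ℝ) (ha : 0 < a) (hr : 0 < r) :
    MeasureTheory.IntegrableOn (fun s : ℝ => Real.exp (-(a^2*s^2)) * Real.exp (-(1/s^2*r^2))) (Set.Ioi 0) ∧
    ∫ s in Set.Ioi (0:ℝ), Real.exp (-(a^2*s^2)) * Real.exp (-(1/s^2*r^2)) = √Real.pi/(2*a) * Real.exp (-(2*a*r)) := by
  set P : ℝ → ℝ := fun s => (Real.exp (-(2*a*r)) * Gf (a*s - r/s) + Real.exp (2*a*r) * Gf (a*s + r/s))/(2*a) with hP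
  set L : ℝ := (Real.exp (-(2*a*r)) * (-(√Real.pi/2)) + Real.exp (2*a*r) * (√Real.pi/2))/(2*a) with hL
  have hderiv : ∀ s ∈ Set.Ioi (0:ℝ), HasDerivAt P (Real.exp (-(a^2*s^2)) * Real.exp (-(1/s^2*r^2))) s := by
    intro s hs
    have hs0 : s ≠ 0 := (Set.mem_Ioi.1 hs).ne'
    have d0 : HasDerivAt (fun s : ℝ => r/s) (-r/s^2) s := by
      have := (hasDerivAt_inv hs0).const_mul r
      exact this.congr_deriv (by ring)
    have d00 : HasDerivAt (fun s : ℝ => a*s) a s := by simpa using (hasDerivAt_id s).const_mul a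
    have d1 : HasDerivAt (fun s : ℝ => a*s - r/s) (a - -r/s^2) s := d00.sub d0
    have d2 : HasDerivAt (fun s : ℝ => a*s + r/s) (a + -r/s^2) s := d00.add d0
    have e1 := ((Gf_deriv _).comp s d1).const_mul (Real.exp (-(2*a*r)))
    have e2 := ((Gf_deriv _).comp s d2).const_mul (Real.exp (2*a*r))
    have e3 := (e1.add e2).div_const (2*a)
    refine HasDerivAt.congr_deriv (f := P) e3 ?_
    have x1 : Real.exp (-(2*a*r)) * Real.exp (-1 * (a*s-r/s)^2) = Real.exp (-(a^2*s^2)) * Real.exp (-(1/s^2*r^2)) := by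
      rw [← Real.exp_add, ← Real.exp_add]; congr 1; field_simp; ring
    have x2 : Real.exp (2*a*r) * Real.exp (-1 * (a*s+r/s)^2) = Real.exp (-(a^2*s^2)) * Real.exp (-(1/s^2*r^2)) := by
      rw [← Real.exp_add, ← Real.exp_add]; congr 1; field_simp; ring
    rw [← mul_assoc, ← mul_assoc, x1, x2]
    field_simp
    ring
  have hinv0 : Filter.Tendsto (fun s : ℝ => r/s) Filter.atTop (nhds 0) := Filter.Tendsto.const_div_atTop Filter.tendsto_id r
  have has : Filter.Tendsto (fun s : ℝ => a*s) Filter.atTop Filter.atTop := Filter.Tendsto.const_mul_atTop ha Filter.tendsto_id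
  have htop : Filter.Tendsto P Filter.atTop (nhds ((Real.exp (-(2*a*r)) * (√Real.pi/2) + Real.exp (2*a*r) * (√Real.pi/2))/(2*a))) := by
    have t1 : Filter.Tendsto (fun s : ℝ => a*s - r/s) Filter.atTop Filter.atTop := by
      simpa [sub_eq_add_neg] using has.atTop_add hinv0.neg
    have t2 : Filter.Tendsto (fun s : ℝ => a*s + r/s) Filter.atTop Filter.atTop := has.atTop_add hinv0
    exact (((Gf_top.comp t1).const_mul _).add ((Gf_top.comp t2).const_mul _)).div_const _
  have hzero : Filter.Tendsto P (nhdsWithin 0 (Set.Ioi 0)) (nhds L) := by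
    have i0 : Filter.Tendsto (fun s : ℝ => r/s) (nhdsWithin 0 (Set.Ioi 0)) Filter.atTop := by
      simpa [div_eq_mul_inv] using Filter.Tendsto.const_mul_atTop hr (tendsto_inv_nhdsGT_zero (𝕜 := ℝ))
    have m0 : Filter.Tendsto (fun s : ℝ => a*s) (nhdsWithin 0 (Set.Ioi 0)) (nhds 0) := by
      have : Continuous (fun s : ℝ => a*s) := by fun_prop
      have := this.tendsto 0
      rw [mul_zero] at this
      exact this.mono_left nhdsWithin_le_nhds
    have t1 : Filter.Tendsto (fun s : ℝ => a*s - r/s) (nhdsWithin 0 (Set.Ioi 0)) Filter.atBot := by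
      simpa [sub_eq_add_neg] using m0.add_atBot (Filter.tendsto_neg_atTop_atBot.comp i0)
    have t2 : Filter.Tendsto (fun s : ℝ => a*s + r/s) (nhdsWithin 0 (Set.Ioi 0)) Filter.atTop := m0.add_atTop i0
    exact (((Gf_bot.comp t1).const_mul _).add ((Gf_top.comp t2).const_mul _)).div_const _
  set P' := Function.update P 0 L with hP'
  have hcont : ContinuousWithinAt P' (Set.Ici 0) 0 := by
    rw [hP', continuousWithinAt_update_same]
    simpa using hzero
  have hderiv' : ∀ s ∈ Set.Ioi (0:ℝ), HasDerivAt P' (Real.exp (-(a^2*s^2)) * Real.exp (-(1/s^2*r^2))) s := by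
    intro s hs
    refine (hderiv s hs).congr_of_eventuallyEq ?_
    filter_upwards [isOpen_Ioi.mem_nhds hs] with u hu
    rw [hP', Function.update_of_ne (Set.mem_Ioi.1 hu).ne']
  have htop' : Filter.Tendsto P' Filter.atTop (nhds ((Real.exp (-(2*a*r)) * (√Real.pi/2) + Real.exp (2*a*r) * (√Real.pi/2))/(2*a))) := by
    refine htop.congr' ?_
    filter_upwards [Filter.eventually_gt_atTop 0] with u hu
    rw [hP', Function.update_of_ne hu.ne']
  have hpos : ∀ s ∈ Set.Ioi (0:ℝ), 0 ≤ Real.exp (-(a^2*s^2)) * Real.exp (-(1/s^2*r^2)) := fun s _ => by positivity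
  refine ⟨MeasureTheory.integrableOn_Ioi_deriv_of_nonneg hcont hderiv' hpos htop', ?_⟩
  rw [MeasureTheory.integral_Ioi_of_hasDerivAt_of_nonneg hcont hderiv' hpos htop', hP', Function.update_self, hL]
  ring

theorem subord (a q : ℝ) (ha : 0 < a) (hq : 0 < q) :
    ∫⁻ s in Set.Ioi (0:ℝ), ENNReal.ofReal (Real.exp (-(a^2*s^2)) * Real.exp (-(1/s^2*q))) =
      ENNReal.ofReal (√Real.pi/(2*a)) * ENNReal.ofReal (Real.exp (-(2*a*√q))) := by
  obtain ⟨h1, h2⟩ := subord_real a (√q) ha (by positivity)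
  rw [Real.sq_sqrt hq.le] at h2
  simp only [Real.sq_sqrt hq.le] at h1
  rw [← ENNReal.ofReal_mul (by positivity), ← h2, MeasureTheory.ofReal_integral_eq_lintegral_ofReal h1]
  exact Filter.Eventually.of_forall (fun s => by positivity)

abbrev NZ := {p : ℤ × ℤ // p ∉ ({0} : Finset (ℤ × ℤ))}

theorem qf_pos (x y : ℝ) (hy : 0 < y) (p : NZ) : 0 < qf x y p := by
  obtain ⟨⟨m, n⟩, hp⟩ := p
  simp only [qf]
  apply div_pos _ hy
  by_cases hn : n = 0
  · subst hn
    have hm : (m:ℝ) ≠ 0 := by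
      intro h
      apply hp
      have : m = 0 := by exact_mod_cast h
      subst this; simp
    simp; positivity
  · have : (n:ℝ) ≠ 0 := by exact_mod_cast hn
    positivity

theorem lsum_eq (x y t : ℝ) (hy : 0 < y) (ht : 0 < t) :
    ENNReal.ofReal (√Real.pi/t) * ∑' p : NZ, ENNReal.ofReal (Real.exp (-(t*√(qf x y p)))) =
    ∫⁻ s in Set.Ioi (0:ℝ), ENNReal.ofReal (Real.exp (-((t/2)^2*s^2)) * (theta (1/s^2) x y - 1)) := by
  rw [← ENNReal.tsum_mul_left]
  have e : ∀ p : NZ, ENNReal.ofReal (√Real.pi/t) * ENNReal.ofReal (Real.exp (-(t*√(qf x y p)))) =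
      ∫⁻ s in Set.Ioi (0:ℝ), ENNReal.ofReal (Real.exp (-((t/2)^2*s^2)) * Real.exp (-(1/s^2*qf x y p))) := by
    intro p
    rw [subord (t/2) _ (by positivity) (qf_pos x y hy p)]
    congr 3 <;> ring
  simp only [e]
  rw [← MeasureTheory.lintegral_tsum (fun p => by fun_prop)]
  refine MeasureTheory.setLIntegral_congr_fun measurableSet_Ioi (fun s hs => ?_)
  have hs0 : 0 < s := hs
  have hsum := summable_theta (1/s^2) x y (by positivity) hy
  have h1 := hsum.sum_add_tsum_subtype_compl {0}
  have h0 : qf x y 0 = 0 := by simp [qf]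
  rw [Finset.sum_singleton, h0] at h1
  have h2 : ∑' p : NZ, Real.exp (-(1/s^2*qf x y p)) = theta (1/s^2) x y - 1 := by
    rw [theta, ← h1]; simp
  rw [← h2, ← tsum_mul_left, ENNReal.ofReal_tsum_of_nonneg (fun _ => by positivity)]
  exact (hsum.subtype _).mul_left _

theorem compare (x y t : ℝ) (hy : 0 < y) (ht : 0 < t)
    (hlt : ∀ β : ℝ, 0 < β → theta β (-1/2) (√3/2) < theta β x y)
    (hs1 : Summable (fun p : NZ => Real.exp (-(t*√(qf (-1/2) (√3/2) p)))))
    (hs2 : Summable (fun p : NZ => Real.exp (-(t*√(qf x y p))))) :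
    ∑' p : NZ, Real.exp (-(t*√(qf (-1/2) (√3/2) p))) < ∑' p : NZ, Real.exp (-(t*√(qf x y p))) := by
  have hh : (0:ℝ) < √3/2 := by positivity
  have hK : 0 < √Real.pi/t := by have := Real.pi_pos; positivity
  have h1 := lsum_eq (-1/2) (√3/2) t hh ht
  have h2 := lsum_eq x y t hy ht
  rw [← ENNReal.ofReal_tsum_of_nonneg (fun _ => (Real.exp_pos _).le) hs1, ← ENNReal.ofReal_mul hK.le] at h1
  rw [← ENNReal.ofReal_tsum_of_nonneg (fun _ => (Real.exp_pos _).le) hs2, ← ENNReal.ofReal_mul hK.le] at h2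
  have h3 : ENNReal.ofReal (√Real.pi/t * ∑' p : NZ, Real.exp (-(t*√(qf (-1/2) (√3/2) p)))) <
      ENNReal.ofReal (√Real.pi/t * ∑' p : NZ, Real.exp (-(t*√(qf x y p)))) := by
    have hfin : ∫⁻ s in Set.Ioi (0:ℝ), ENNReal.ofReal (Real.exp (-((t/2)^2*s^2)) * (theta (1/s^2) (-1/2) (√3/2) - 1)) ≠ ⊤ := by
      rw [← h1]; exact ENNReal.ofReal_ne_top
    rw [h1, h2]
    refine MeasureTheory.lintegral_strict_mono ?_ ?_ hfin ?_
    · intro h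
      have := congrArg (fun μ => μ Set.univ) h
      simp at this
    · refine Measurable.aemeasurable ?_
      have : Measurable (fun s : ℝ => theta (1/s^2) x y) := by
        unfold theta
        refine Measurable.tsum (fun p => ?_)
        fun_prop
      fun_prop
    · refine (MeasureTheory.ae_restrict_iff' measurableSet_Ioi).2 (Filter.Eventually.of_forall (fun s hs => ?_))
      have hs0 : 0 < s := hs
      have hl := hlt (1/s^2) (by positivity)
      have h1' : 1 ≤ theta (1/s^2) (-1/2) (√3/2) := by
        have hsum := summable_theta (1/s^2) (-1/2) (√3/2) (by positivity) hh
        have := hsum.le_tsum 0 (fun _ _ => (Real.exp_pos _).le)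
        simpa [qf, theta] using this
      have hw := Real.exp_pos (-((t/2)^2*s^2))
      apply (ENNReal.ofReal_lt_ofReal_iff (mul_pos hw (by linarith))).2
      apply mul_lt_mul_of_pos_left _ hw
      linarith
  have h4 := (ENNReal.ofReal_lt_ofReal_iff_of_nonneg (mul_nonneg hK.le (tsum_nonneg (fun _ => (Real.exp_pos _).le)))).1 h3
  exact lt_of_mul_lt_mul_left h4 hK.le

theorem act_zero' (A : Matrix (Fin 2) (Fin 2) ℝ) (v : EuclideanSpace ℝ (Fin 2)) :
    act A v 0 = A 0 0 * v 0 + A 0 1 * v 1 := by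
  simp [act]

theorem act_one' (A : Matrix (Fin 2) (Fin 2) ℝ) (v : EuclideanSpace ℝ (Fin 2)) :
    act A v 1 = A 1 0 * v 0 + A 1 1 * v 1 := by
  simp [act]

theorem ext2 (v w : EuclideanSpace ℝ (Fin 2)) (h0 : v 0 = w 0) (h1 : v 1 = w 1) : v = w := by
  ext i
  fin_cases i
  · exact h0
  · exact h1

theorem act_smul' (A : Matrix (Fin 2) (Fin 2) ℝ) (c : ℝ) (v : EuclideanSpace ℝ (Fin 2)) :
    act A (c • v) = c • act A v := by
  apply ext2
  · rw [PiLp.smul_apply, act_zero', act_zero', PiLp.smul_apply, PiLp.smul_apply]; simp only [smul_eq_mul]; ring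
  · rw [PiLp.smul_apply, act_one', act_one', PiLp.smul_apply, PiLp.smul_apply]; simp only [smul_eq_mul]; ring

def phiM (M : Matrix (Fin 2) (Fin 2) ℝ) (p : ℤ × ℤ) : EuclideanSpace ℝ (Fin 2) :=
  !₂[M 0 0 * p.1 + M 0 1 * p.2, M 1 0 * p.1 + M 1 1 * p.2]

theorem phiM_zero (M : Matrix (Fin 2) (Fin 2) ℝ) (p : ℤ × ℤ) : phiM M p 0 = M 0 0 * p.1 + M 0 1 * p.2 := by
  simp [phiM]

theorem phiM_one (M : Matrix (Fin 2) (Fin 2) ℝ) (p : ℤ × ℤ) : phiM M p 1 = M 1 0 * p.1 + M 1 1 * p.2 := by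
  simp [phiM]

theorem phiM_sub (M : Matrix (Fin 2) (Fin 2) ℝ) (p q : ℤ × ℤ) : phiM M (p - q) = phiM M p - phiM M q := by
  apply ext2
  · rw [PiLp.sub_apply, phiM_zero, phiM_zero, phiM_zero]; simp only [Prod.fst_sub, Prod.snd_sub]; push_cast; ring
  · rw [PiLp.sub_apply, phiM_one, phiM_one, phiM_one]; simp only [Prod.fst_sub, Prod.snd_sub]; push_cast; ring

theorem norm_phiM (M : Matrix (Fin 2) (Fin 2) ℝ) (p : ℤ × ℤ) :
    ‖phiM M p‖ = √((M 0 0 * p.1 + M 0 1 * p.2)^2 + (M 1 0 * p.1 + M 1 1 * p.2)^2) := by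
  rw [EuclideanSpace.norm_eq, Fin.sum_univ_two, phiM_zero, phiM_one, Real.norm_eq_abs, Real.norm_eq_abs, sq_abs, sq_abs]

theorem range_intLat (A : Matrix (Fin 2) (Fin 2) ℝ) : act A '' intLat = Set.range (phiM A) := by
  ext v
  constructor
  · rintro ⟨w, ⟨a, b, h0, h1⟩, rfl⟩
    refine ⟨(a,b), ?_⟩
    apply ext2
    · rw [phiM_zero, act_zero', h0, h1]
    · rw [phiM_one, act_one', h0, h1]
  · rintro ⟨p, rfl⟩
    refine ⟨!₂[(p.1:ℝ), (p.2:ℝ)], ⟨p.1, p.2, by simp, by simp⟩, ?_⟩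
    apply ext2
    · rw [phiM_zero, act_zero']; simp
    · rw [phiM_one, act_one']; simp

def T0 : Matrix (Fin 2) (Fin 2) ℝ :=
  !![√(2/√3), √(2/√3)/2; 0, √(2/√3)*√3/2]

theorem range_triLat (R : Matrix (Fin 2) (Fin 2) ℝ) : act R '' triLat = Set.range (phiM (R * T0)) := by
  ext v
  constructor
  · rintro ⟨w, ⟨a, b, h0, h1⟩, rfl⟩
    refine ⟨(a,b), ?_⟩
    apply ext2
    · rw [phiM_zero, act_zero', h0, h1]; simp [T0, Matrix.mul_apply, Fin.sum_univ_two]; ring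
    · rw [phiM_one, act_one', h0, h1]; simp [T0, Matrix.mul_apply, Fin.sum_univ_two]; ring
  · rintro ⟨p, rfl⟩
    refine ⟨!₂[(p.1:ℝ)*√(2/√3) + p.2*√(2/√3)/2, (p.2:ℝ)*√(2/√3)*√3/2], ⟨p.1, p.2, by simp, by simp⟩, ?_⟩
    apply ext2
    · rw [phiM_zero, act_zero']; simp [T0, Matrix.mul_apply, Fin.sum_univ_two]; ring
    · rw [phiM_one, act_one']; simp [T0, Matrix.mul_apply, Fin.sum_univ_two]; ring

theorem range_mul_int (M : Matrix (Fin 2) (Fin 2) ℝ) (a b c d : ℤ) (h : (a*d-b*c)*(a*d-b*c) = 1) :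
    Set.range (phiM (M * !![(a:ℝ), b; c, d])) = Set.range (phiM M) := by
  have : phiM (M * !![(a:ℝ), b; c, d]) = phiM M ∘ intEquiv a b c d h := by
    funext p
    apply ext2
    · rw [Function.comp, phiM_zero, phiM_zero]; simp [intEquiv, Matrix.mul_apply, Fin.sum_univ_two]; ring
    · rw [Function.comp, phiM_one, phiM_one]; simp [intEquiv, Matrix.mul_apply, Fin.sum_univ_two]; ring
  rw [this, (intEquiv a b c d h).surjective.range_comp]

theorem fEnt_eq (n k : ℕ) (hn : 1 ≤ n) (t : ℝ) (A M : Matrix (Fin 2) (Fin 2) ℝ) (hA : A.det = 1)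
    (x y : ℝ) (hy : 0 < y) (hr : act A '' intLat = Set.range (phiM M))
    (hq : ∀ p, ‖phiM M p‖ = √(qf x y p)) :
    fEnt n k t A = ∑' p : NZ, Real.exp (-(t/√(n*(k+1))*√(qf x y p))) := by
  have hs : 0 < √((n:ℝ)*(k+1)) := by
    have : (0:ℝ) < n := by exact_mod_cast hn
    positivity
  rw [Matrix.det_fin_two] at hA
  generalize hsd : √((n:ℝ)*(k+1)) = s at hs
  have hne : ∀ p : NZ, phiM M p ≠ 0 := by
    intro p h
    have h1 := hq p
    rw [h, norm_zero] at h1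
    have := Real.sqrt_pos.2 (qf_pos x y hy p)
    linarith
  have hinj : Function.Injective (fun p : NZ => s⁻¹ • phiM M p) := by
    intro p q hpq
    have h1 : phiM M p = phiM M q := smul_right_injective _ (inv_ne_zero hs.ne') hpq
    have h2 : phiM M (p.1 - q.1) = 0 := by rw [phiM_sub, h1, sub_self]
    by_contra hne'
    have h3 : (p.1 - q.1) ∉ ({0} : Finset (ℤ × ℤ)) := by
      rw [Finset.mem_singleton, sub_eq_zero]
      intro h; exact hne' (Subtype.ext h)
    exact hne ⟨_, h3⟩ h2
  have hrange : act A '' Lam n k = Set.range (fun p : NZ => s⁻¹ • phiM M p) := by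
    ext v
    constructor
    · rintro ⟨w, ⟨a, b, hab, h0, h1⟩, rfl⟩
      rw [hsd] at h0 h1
      have hw : act A (s • w) ∈ act A '' intLat := by
        refine ⟨s • w, ⟨a, b, ?_, ?_⟩, rfl⟩
        · rw [PiLp.smul_apply, h0, smul_eq_mul]; field_simp
        · rw [PiLp.smul_apply, h1, smul_eq_mul]; field_simp
      rw [hr] at hw
      obtain ⟨p, hp⟩ := hw
      rw [act_smul'] at hp
      refine ⟨⟨p, ?_⟩, ?_⟩
      · rw [Finset.mem_singleton]
        rintro rfl
        apply hab
        have hz : phiM M 0 = 0 := by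
          have := phiM_sub M 0 0
          simpa using this
        rw [hz] at hp
        have hz2 : act A w = 0 := by
          rcases smul_eq_zero.1 hp.symm with h | h
          · exact absurd h hs.ne'
          · exact h
        have g0 := act_zero' A w
        have g1 := act_one' A w
        rw [hz2] at g0 g1
        simp only [PiLp.zero_apply] at g0 g1
        have w0 : w 0 = 0 := by linear_combination (-w 0) * hA - A 1 1 * g0 + A 0 1 * g1
        have w1 : w 1 = 0 := by linear_combination (-w 1) * hA + A 1 0 * g0 - A 0 0 * g1
        rw [h0] at w0
        rw [h1] at w1
        have hs' := hs.ne'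
        constructor
        · have : (a:ℝ) = 0 := by simpa [hs'] using w0
          exact_mod_cast this
        · have : (b:ℝ) = 0 := by simpa [hs'] using w1
          exact_mod_cast this
      · simp only
        rw [hp, smul_smul, inv_mul_cancel₀ hs.ne', one_smul]
    · rintro ⟨p, rfl⟩
      have hp : phiM M p ∈ act A '' intLat := by rw [hr]; exact ⟨p, rfl⟩
      obtain ⟨w, ⟨a, b, h0, h1⟩, hw⟩ := hp
      refine ⟨s⁻¹ • w, ⟨a, b, ?_, ?_, ?_⟩, ?_⟩
      · rintro ⟨rfl, rfl⟩
        apply hne p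
        rw [← hw]
        apply ext2
        · rw [act_zero', h0, h1]; simp
        · rw [act_one', h0, h1]; simp
      · rw [hsd, PiLp.smul_apply, h0, smul_eq_mul]; field_simp
      · rw [hsd, PiLp.smul_apply, h1, smul_eq_mul]; field_simp
      · rw [act_smul', hw]
  unfold fEnt
  rw [hrange, tsum_range (fun v : EuclideanSpace ℝ (Fin 2) => Real.exp (-t * ‖v‖)) hinj]
  congr 1
  ext p
  rw [norm_smul, hq, Real.norm_of_nonneg (inv_nonneg.2 hs.le)]
  congr 1
  field_simp

theorem qf_matrix (A : Matrix (Fin 2) (Fin 2) ℝ) (hA : A.det = 1) :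
    0 < A 0 0^2 + A 1 0^2 ∧ ∀ p : ℤ × ℤ, (A 0 0 * p.1 + A 0 1 * p.2)^2 + (A 1 0 * p.1 + A 1 1 * p.2)^2 =
      qf ((A 0 0 * A 0 1 + A 1 0 * A 1 1)/(A 0 0^2 + A 1 0^2)) (1/(A 0 0^2 + A 1 0^2)) p := by
  rw [Matrix.det_fin_two] at hA
  have hN : 0 < A 0 0^2 + A 1 0^2 := by
    by_contra h
    have h1 : A 0 0 = 0 := by nlinarith [sq_nonneg (A 0 0), sq_nonneg (A 1 0)]
    have h2 : A 1 0 = 0 := by nlinarith [sq_nonneg (A 0 0), sq_nonneg (A 1 0)]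
    rw [h1, h2] at hA
    norm_num at hA
  refine ⟨hN, fun p => ?_⟩
  generalize A 0 0 = a at *
  generalize A 0 1 = b at *
  generalize A 1 0 = c at *
  generalize A 1 1 = d at *
  obtain ⟨m, n⟩ := p
  simp only [qf]
  field_simp
  linear_combination (n:ℝ)^2 * (a*d-b*c+1) * hA

theorem c0_sq : √(2/√3)^2 * √3 = 2 := by
  rw [Real.sq_sqrt (by positivity)]
  field_simp

theorem rot_cols (R : Matrix (Fin 2) (Fin 2) ℝ) (hR : R * R.transpose = 1) :
    R 0 0^2 + R 1 0^2 = 1 ∧ R 0 0 * R 0 1 + R 1 0 * R 1 1 = 0 ∧ R 0 1^2 + R 1 1^2 = 1 := by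
  have h := mul_eq_one_comm.1 hR
  have h00 := congrFun (congrFun h 0) 0
  have h01 := congrFun (congrFun h 0) 1
  have h11 := congrFun (congrFun h 1) 1
  simp [Matrix.mul_apply, Fin.sum_univ_two] at h00 h01 h11
  refine ⟨by linarith, by linarith, by linarith⟩

theorem hex_norm (R : Matrix (Fin 2) (Fin 2) ℝ) (hR : R * R.transpose = 1) (p : ℤ × ℤ) :
    ‖phiM (R * T0 * !![((1:ℤ):ℝ), (0:ℤ); (0:ℤ), (-1:ℤ)]) p‖ = √(qf (-1/2) (√3/2) p) := by
  obtain ⟨h1, h2, h3⟩ := rot_cols R hR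
  rw [norm_phiM, qf_hex]
  congr 1
  have hc := c0_sq
  have hs : √3 ^ 2 = (3:ℝ) := Real.sq_sqrt (by norm_num)
  have hs0 : 0 < √3 := by positivity
  have t00 : T0 0 0 = √(2/√3) := rfl
  have t01 : T0 0 1 = √(2/√3)/2 := rfl
  have t10 : T0 1 0 = 0 := rfl
  have t11 : T0 1 1 = √(2/√3)*√3/2 := rfl
  generalize √(2/√3) = c at *
  simp [t00, t01, t10, t11, nrm, Matrix.mul_apply, Fin.sum_univ_two]
  generalize √3 = s at *
  generalize R 0 0 = r at *
  generalize R 0 1 = r1 at *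
  generalize R 1 0 = r2 at *
  generalize R 1 1 = r3 at *
  obtain ⟨m, n⟩ := p
  simp only
  generalize (m:ℝ) = m
  generalize (n:ℝ) = n
  have e : 2/s = c^2 := by rw [← hc]; field_simp
  rw [e]
  linear_combination c^2*(m-n/2)^2 * h1 + c^2*s^2*n^2/4*h3 - c^2*s*n*(m-n/2)*h2 + c^2*n^2/4*hs

theorem tri_of_hex (A : Matrix (Fin 2) (Fin 2) ℝ) (hA : A.det = 1) (a b c d : ℤ) (h : a*d-b*c = 1)
    (hq : ∀ m n : ℤ, (A 0 0 * (a*m+b*n) + A 0 1 * (c*m+d*n))^2 + (A 1 0 * (a*m+b*n) + A 1 1 * (c*m+d*n))^2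
      = 2/√3*((m:ℝ)^2+m*n+n^2)) :
    ∃ R : Matrix (Fin 2) (Fin 2) ℝ, IsRotation R ∧ act A '' intLat = act R '' triLat := by
  have hc := c0_sq
  have hs : √3 ^ 2 = (3:ℝ) := Real.sq_sqrt (by norm_num)
  have hs0 : 0 < √3 := by positivity
  have e : 2/√3 = √(2/√3)^2 := by rw [Real.sq_sqrt (by positivity)]
  let G : Matrix (Fin 2) (Fin 2) ℝ := !![(a:ℝ), b; c, d]
  let T1 : Matrix (Fin 2) (Fin 2) ℝ := !![√(2/√3)*√3/2, -√(2/√3)/2; 0, √(2/√3)]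
  have t00 : T0 0 0 = √(2/√3) := rfl
  have t01 : T0 0 1 = √(2/√3)/2 := rfl
  have t10 : T0 1 0 = 0 := rfl
  have t11 : T0 1 1 = √(2/√3)*√3/2 := rfl
  have u00 : T1 0 0 = √(2/√3)*√3/2 := rfl
  have u01 : T1 0 1 = -√(2/√3)/2 := rfl
  have u10 : T1 1 0 = 0 := rfl
  have u11 : T1 1 1 = √(2/√3) := rfl
  clear_value T1
  rw [e] at hq
  generalize √(2/√3) = u at *
  have hT : T1 * T0 = 1 := by
    ext i j
    fin_cases i <;> fin_cases j <;> simp [t00, t01, t10, t11, u00, u01, u10, u11, Matrix.mul_apply, Fin.sum_univ_two]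
    · linear_combination (1/2)*hc
    · ring
    · linear_combination (1/2)*hc
  have hT1 : T1.det = 1 := by
    rw [Matrix.det_fin_two, u00, u01, u10, u11]; linear_combination (1/2)*hc
  have hG : G.det = 1 := by
    rw [Matrix.det_fin_two]; simp [G]; exact_mod_cast h
  have h' : (a*d-b*c)*(a*d-b*c) = 1 := by rw [h]; norm_num
  refine ⟨A * G * T1, ⟨by rw [Matrix.det_mul, Matrix.det_mul, hA, hG, hT1]; norm_num, ?_⟩, ?_⟩
  · apply mul_eq_one_comm.1
    have q1 := hq 1 0
    have q2 := hq 0 1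
    have q3 := hq 1 1
    push_cast at q1 q2 q3
    obtain ⟨M, hM⟩ : ∃ M, M = A * G := ⟨_, rfl⟩
    have m00 : M 0 0 = A 0 0 * a + A 0 1 * c := by rw [hM]; simp [G, Matrix.mul_apply, Fin.sum_univ_two]
    have m01 : M 0 1 = A 0 0 * b + A 0 1 * d := by rw [hM]; simp [G, Matrix.mul_apply, Fin.sum_univ_two]
    have m10 : M 1 0 = A 1 0 * a + A 1 1 * c := by rw [hM]; simp [G, Matrix.mul_apply, Fin.sum_univ_two]
    have m11 : M 1 1 = A 1 0 * b + A 1 1 * d := by rw [hM]; simp [G, Matrix.mul_apply, Fin.sum_univ_two]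
    have p1 : M 0 0^2 + M 1 0^2 = u^2 := by rw [m00, m10]; linear_combination q1
    have p2 : M 0 1^2 + M 1 1^2 = u^2 := by rw [m01, m11]; linear_combination q2
    have p3 : M 0 0*M 0 1 + M 1 0*M 1 1 = u^2/2 := by
      rw [m00, m01, m10, m11]; linear_combination q3/2 - q1/2 - q2/2
    rw [← hM]
    ext i j
    fin_cases i <;> fin_cases j <;> simp [u00, u01, u10, u11, Matrix.mul_apply, Fin.sum_univ_two]
    · linear_combination u^2*√3^2/4*p1 + (u^2*√3+2)/4*hc
    · linear_combination -u^2*√3/4*p1 + u^2*√3/2*p3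
    · linear_combination -u^2*√3/4*p1 + u^2*√3/2*p3
    · linear_combination u^2/4*p1 - u^2*p3 + u^2*p2 + (u^2*√3+2)/4*hc - u^4/4*hs
  · rw [range_intLat, range_triLat, Matrix.mul_assoc, hT, Matrix.mul_one, range_mul_int A a b c d h']

theorem entropy_minimized_at_equilateral
    (n k : ℕ) (hn : 1 ≤ n) (hk : 1 ≤ k)
    (A B : Matrix (Fin 2) (Fin 2) ℝ) (hA : A.det = 1) (hB : B.det = 1)
    (hBtri : ∃ R : Matrix (Fin 2) (Fin 2) ℝ, IsRotation R ∧
      act B '' intLat = act R '' triLat)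
    (hAnottri : ¬ ∃ R : Matrix (Fin 2) (Fin 2) ℝ, IsRotation R ∧
      act A '' intLat = act R '' triLat)
    (hA_ : ℝ) (hB_ : ℝ) (hA_pos : 0 < hA_) (hB_pos : 0 < hB_)
    (hA_eq : fEnt n k hA_ A = 1 / (k : ℝ))
    (hB_eq : fEnt n k hB_ B = 1 / (k : ℝ)) :
    hB_ < hA_ := by
  obtain ⟨R, hR, hBR⟩ := hBtri
  obtain ⟨hN, hqA⟩ := qf_matrix A hA
  have hk0 : (0:ℝ) < k := by exact_mod_cast hk
  have hk1 : (0:ℝ) < 1/(k:ℝ) := by positivity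
  have hs : 0 < √((n:ℝ)*(k+1)) := by
    have : (0:ℝ) < n := by exact_mod_cast hn
    positivity
  generalize hxd : (A 0 0 * A 0 1 + A 1 0 * A 1 1)/(A 0 0^2 + A 1 0^2) = x at hqA
  generalize hyd : 1/(A 0 0^2 + A 1 0^2) = y at hqA
  have hy : 0 < y := by rw [← hyd]; positivity
  have hh : (0:ℝ) < √3/2 := by positivity
  have hlt : ∀ β : ℝ, 0 < β → theta β (-1/2) (√3/2) < theta β x y := by
    rcases hex_or_lt x y hy with h | ⟨a, b, c, d, hdet, hq⟩
    · exact h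
    · exfalso
      apply hAnottri
      refine tri_of_hex A hA a b c d hdet (fun m n => ?_)
      rw [← hq m n, ← hqA]
      push_cast
      ring
  have hfA : ∀ t, fEnt n k t A = ∑' p : NZ, Real.exp (-(t/√(n*(k+1))*√(qf x y p))) := by
    intro t
    refine fEnt_eq n k hn t A A hA x y hy (range_intLat A) (fun p => ?_)
    rw [norm_phiM, hqA]
  have hfB : fEnt n k hB_ B = ∑' p : NZ, Real.exp (-(hB_/√(n*(k+1))*√(qf (-1/2) (√3/2) p))) := by
    refine fEnt_eq n k hn hB_ B _ hB (-1/2) (√3/2) hh ?_ (hex_norm R hR.2)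
    rw [hBR, range_triLat, range_mul_int _ _ _ _ _ (by norm_num)]
  generalize √((n:ℝ)*(k+1)) = s at hs hfA hfB
  rw [hfA] at hA_eq
  rw [hfB] at hB_eq
  have hsB : Summable (fun p : NZ => Real.exp (-(hB_/s*√(qf (-1/2) (√3/2) p)))) := by
    by_contra h
    rw [tsum_eq_zero_of_not_summable h] at hB_eq
    linarith
  have hsA : Summable (fun p : NZ => Real.exp (-(hA_/s*√(qf x y p)))) := by
    by_contra h
    rw [tsum_eq_zero_of_not_summable h] at hA_eq
    linarith
  by_contra hcon
  rw [not_lt] at hcon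
  have hle : ∀ p : NZ, Real.exp (-(hB_/s*√(qf x y p))) ≤ Real.exp (-(hA_/s*√(qf x y p))) := by
    intro p
    apply Real.exp_le_exp.2
    have : hA_/s*√(qf x y p) ≤ hB_/s*√(qf x y p) := by gcongr
    linarith
  have hsA' : Summable (fun p : NZ => Real.exp (-(hB_/s*√(qf x y p)))) :=
    Summable.of_nonneg_of_le (fun _ => (Real.exp_pos _).le) hle hsA
  have h1 := hsA'.tsum_le_tsum hle hsA
  have h2 := compare x y (hB_/s) hy (by positivity) hlt hsB hsA'
  linarith
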